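/- Let L ≥ 2, J ∈ ℝ with J ≠ 0, η ∈ ℂ with sinh η ≠ 0, and β ∈ ℂ; set Δ = cosh η. Then the Trotter-type limit lim_{M→∞} [T(0)⁻¹ · T(β/(2M))]^{M} = exp(β H₀ / (4 J sinh η)) holds, where the limit is taken in the space of linear operators on (ℂ²)^{⊗L} (the factor T(β/(2M)) is defined for all sufficiently large M since sinh(β/(2M)+η) → sinh η ≠ 0, and exp denotes the matrix exponential). -/

import Mathlib

open Complex Matrix

/-- The six-vertex R-matrix on ℂ² ⊗ ℂ², in the basis `e₁⊗e₁, e₁⊗e₂, e₂⊗e₁, e₂⊗e₂`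
(encoded as pairs `(0,0), (0,1), (1,0), (1,1)` in `Fin 2 × Fin 2`). -/
noncomputable def Rmat (η lam : ℂ) : Matrix (Fin 2 × Fin 2) (Fin 2 × Fin 2) ℂ :=
  Matrix.of fun p q =>
    if p = q then (if p.1 = p.2 then 1 else Complex.sinh lam / Complex.sinh (lam + η))
    else if p.1 = q.2 ∧ p.2 = q.1 ∧ p.1 ≠ p.2 then Complex.sinh η / Complex.sinh (lam + η)
    else 0

/-- Basis states of the chain `(ℂ²)^{⊗L}`. -/
abbrev Chain (L : ℕ) := Fin L → Fin 2

/-- `R_{aj}(λ)`: the R-matrix acting on the auxiliary factor and the `j`-th site of the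
chain, and as the identity on all other sites. -/
noncomputable def Raux (L : ℕ) (η lam : ℂ) (j : Fin L) :
    Matrix (Fin 2 × Chain L) (Fin 2 × Chain L) ℂ :=
  Matrix.of fun p q =>
    Rmat η lam (p.1, p.2 j) (q.1, q.2 j) * (if ∀ k, k ≠ j → p.2 k = q.2 k then 1 else 0)

/-- The monodromy matrix `𝒯_a(λ) = R_{aL}(λ) ⋯ R_{a2}(λ) R_{a1}(λ)` on `ℂ²_a ⊗ (ℂ²)^{⊗L}`. -/
noncomputable def monodromy (L : ℕ) (η lam : ℂ) :
    Matrix (Fin 2 × Chain L) (Fin 2 × Chain L) ℂ :=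
  ((List.ofFn fun j : Fin L => Raux L η lam j).reverse).prod

/-- `A(λ)`, the upper-left block of the monodromy matrix w.r.t. the auxiliary space. -/
noncomputable def Aop (L : ℕ) (η lam : ℂ) : Matrix (Chain L) (Chain L) ℂ :=
  Matrix.of fun v w => monodromy L η lam (0, v) (0, w)

/-- `B(λ)`, the upper-right block of the monodromy matrix w.r.t. the auxiliary space. -/
noncomputable def Bop (L : ℕ) (η lam : ℂ) : Matrix (Chain L) (Chain L) ℂ :=
  Matrix.of fun v w => monodromy L η lam (0, v) (1, w)

/-- `C(λ)`, the lower-left block of the monodromy matrix w.r.t. the auxiliary space. -/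
noncomputable def Cop (L : ℕ) (η lam : ℂ) : Matrix (Chain L) (Chain L) ℂ :=
  Matrix.of fun v w => monodromy L η lam (1, v) (0, w)

/-- `D(λ)`, the lower-right block of the monodromy matrix w.r.t. the auxiliary space. -/
noncomputable def Dop (L : ℕ) (η lam : ℂ) : Matrix (Chain L) (Chain L) ℂ :=
  Matrix.of fun v w => monodromy L η lam (1, v) (1, w)

/-- The transfer matrix `T(λ) = Tr_a 𝒯_a(λ) = A(λ) + D(λ)` on `(ℂ²)^{⊗L}`. -/
noncomputable def transfer (L : ℕ) (η lam : ℂ) : Matrix (Chain L) (Chain L) ℂ :=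
  Matrix.of fun v w => ∑ a : Fin 2, monodromy L η lam (a, v) (a, w)

/-- The Pauli matrices `σ^x, σ^y, σ^z` (indexed by `0, 1, 2` ↔ `x, y, z`). -/
noncomputable def pauli : Fin 3 → Matrix (Fin 2) (Fin 2) ℂ :=
  ![!![0, 1; 1, 0], !![0, -Complex.I; Complex.I, 0], !![1, 0; 0, -1]]

/-- `σ_j`: the one-site operator `m` acting on the `j`-th tensor factor of `(ℂ²)^{⊗L}`
and as the identity on all other factors. -/
noncomputable def siteOp (L : ℕ) (m : Matrix (Fin 2) (Fin 2) ℂ) (j : Fin L) :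
    Matrix (Chain L) (Chain L) ℂ :=
  Matrix.of fun v w => m (v j) (w j) * (if ∀ k, k ≠ j → v k = w k then 1 else 0)

/-- The spin-1/2 XXZ Hamiltonian with periodic boundary conditions:
`H₀ = J Σ_j [σ_j^x σ_{j+1}^x + σ_j^y σ_{j+1}^y + Δ(σ_j^z σ_{j+1}^z − 1)]`,
with site indices modulo `L`. -/
noncomputable def XXZham (L : ℕ) [NeZero L] (J : ℝ) (Δ : ℂ) :
    Matrix (Chain L) (Chain L) ℂ :=
  (J : ℂ) • ∑ j : Fin L,
    (siteOp L (pauli 0) j * siteOp L (pauli 0) (j + 1) +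
      siteOp L (pauli 1) j * siteOp L (pauli 1) (j + 1) +
      Δ • (siteOp L (pauli 2) j * siteOp L (pauli 2) (j + 1) - 1))

/-- The total spin operator `S^z = (1/2) Σ_j σ_j^z`. -/
noncomputable def Sz (L : ℕ) : Matrix (Chain L) (Chain L) ℂ :=
  (2 : ℂ)⁻¹ • ∑ j : Fin L, siteOp L (pauli 2) j

/-- The matrix exponential, given by its everywhere-convergent power series
`exp A = Σ_{n≥0} Aⁿ/n!`. -/
noncomputable def mexp {ι : Type*} [Fintype ι] [DecidableEq ι] (A : Matrix ι ι ℂ) :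
    Matrix ι ι ℂ :=
  ∑' n : ℕ, ((n.factorial : ℂ)⁻¹ • A ^ n)

section TrotterProduct

variable {𝔸 : Type*} [NormedRing 𝔸]

theorem norm_pow_sub_pow_le_mul [NormOneClass 𝔸] {a b : 𝔸} {C : ℝ} (ha : ‖a‖ ≤ C)
    (hb : ‖b‖ ≤ C) (hC : 1 ≤ C) (n : ℕ) :
    ‖a ^ n - b ^ n‖ ≤ n * C ^ n * ‖a - b‖ := by
  induction n with
  | zero => simp
  | succ n ih =>
    have hC0 : 0 ≤ C := zero_le_one.trans hC
    have hCn : C ^ n ≤ C ^ (n + 1) := pow_le_pow_right₀ hC n.le_succ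
    calc ‖a ^ (n + 1) - b ^ (n + 1)‖ = ‖a ^ n * (a - b) + (a ^ n - b ^ n) * b‖ := by
          congr 1; noncomm_ring
      _ ≤ ‖a‖ ^ n * ‖a - b‖ + ‖a ^ n - b ^ n‖ * ‖b‖ :=
          (norm_add_le _ _).trans (add_le_add
            ((norm_mul_le _ _).trans (mul_le_mul_of_nonneg_right (norm_pow_le _ _)
              (norm_nonneg _))) (norm_mul_le _ _))
      _ ≤ C ^ (n + 1) * ‖a - b‖ + n * C ^ n * ‖a - b‖ * C := by
          gcongr
          exact (pow_le_pow_left₀ (norm_nonneg _) ha n).trans hCn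
      _ = (n + 1 : ℕ) * C ^ (n + 1) * ‖a - b‖ := by push_cast; ring

variable {𝕜 : Type*} [RCLike 𝕜] [NormedAlgebra 𝕜 𝔸]

theorem HasDerivAt.exists_eventually_norm_le_exp [NormOneClass 𝔸] {G : 𝕜 → 𝔸} {X : 𝔸}
    (hG : HasDerivAt G X 0) (h0 : G 0 = 1) :
    ∃ K : ℝ, ∀ᶠ t in nhds (0 : 𝕜), ‖G t‖ ≤ Real.exp (K * ‖t‖) := by
  obtain ⟨K, hK⟩ := hG.isBigO_sub.bound
  refine ⟨K, hK.mono fun t ht => ?_⟩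
  rw [h0, sub_zero] at ht
  calc ‖G t‖ = ‖(G t - 1) + 1‖ := by rw [sub_add_cancel]
    _ ≤ K * ‖t‖ + 1 := (norm_add_le _ _).trans (by rw [norm_one]; gcongr)
    _ ≤ Real.exp (K * ‖t‖) := Real.add_one_le_exp _

/-- A curve through `1` with velocity `X` satisfies `G (1 / n) ^ n → exp X`. -/
theorem HasDerivAt.tendsto_pow_inv_natCast_exp [NormOneClass 𝔸] [CompleteSpace 𝔸]
    {G : 𝕜 → 𝔸} {X : 𝔸} (hG : HasDerivAt G X 0) (h0 : G 0 = 1) :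
    Filter.Tendsto (fun n : ℕ => G ((n : 𝕜)⁻¹) ^ n) Filter.atTop
      (nhds (NormedSpace.exp X)) := by
  let _ : NormedAlgebra ℚ 𝔸 := NormedAlgebra.restrictScalars ℚ 𝕜 𝔸
  set E : 𝕜 → 𝔸 := fun t => NormedSpace.exp (t • X) with hEdef
  have hE : HasDerivAt E X 0 := by
    simpa [E] using hasDerivAt_exp_smul_const (𝕂 := 𝕜) X 0
  have hE0 : E 0 = 1 := by simp [E]
  have htend : Filter.Tendsto (fun n : ℕ => (n : 𝕜)⁻¹) Filter.atTop (nhds 0) :=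
    tendsto_inv_atTop_nhds_zero_nat
  have hEpow : ∀ᶠ n : ℕ in Filter.atTop, E ((n : 𝕜)⁻¹) ^ n = NormedSpace.exp X := by
    filter_upwards [Filter.eventually_gt_atTop 0] with n hn
    have hn' : (n : 𝕜) ≠ 0 := by exact_mod_cast hn.ne'
    rw [hEdef, ← NormedSpace.exp_nsmul, ← Nat.cast_smul_eq_nsmul 𝕜, smul_smul,
      mul_inv_cancel₀ hn', one_smul]
  obtain ⟨K₁, hK₁⟩ := hG.exists_eventually_norm_le_exp h0
  obtain ⟨K₂, hK₂⟩ := hE.exists_eventually_norm_le_exp hE0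
  set K := max (max K₁ K₂) 0
  have hD : (fun t => G t - E t) =o[nhds 0] fun t : 𝕜 => t := by
    simpa [h0, hE0] using (hG.sub hE).isLittleO
  have hlim : Filter.Tendsto (fun n : ℕ => Real.exp K *
      (‖G ((n : 𝕜)⁻¹) - E ((n : 𝕜)⁻¹)‖ / ‖(n : 𝕜)⁻¹‖)) Filter.atTop (nhds 0) := by
    simpa using ((hD.comp_tendsto htend).norm_norm.tendsto_div_nhds_zero).const_mul
      (Real.exp K)
  have hdiff : Filter.Tendsto (fun n : ℕ => G ((n : 𝕜)⁻¹) ^ n - E ((n : 𝕜)⁻¹) ^ n)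
      Filter.atTop (nhds 0) := by
    refine squeeze_zero_norm' ?_ hlim
    filter_upwards [Filter.eventually_gt_atTop 0, htend.eventually hK₁,
      htend.eventually hK₂] with n hn h₁ h₂
    have hn' : (n : ℝ) ≠ 0 := by exact_mod_cast hn.ne'
    have hnorm : ‖(n : 𝕜)⁻¹‖ = (n : ℝ)⁻¹ := by simp
    have hle : ∀ K' ≤ K, Real.exp (K' * ‖(n : 𝕜)⁻¹‖) ≤ Real.exp (K * ‖(n : 𝕜)⁻¹‖) :=
      fun K' h => by gcongr
    have hone : 1 ≤ Real.exp (K * ‖(n : 𝕜)⁻¹‖) :=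
      Real.one_le_exp (mul_nonneg (le_max_right _ _) (norm_nonneg _))
    refine (norm_pow_sub_pow_le_mul
      (h₁.trans (hle _ ((le_max_left _ _).trans (le_max_left _ _))))
      (h₂.trans (hle _ ((le_max_right _ _).trans (le_max_left _ _)))) hone n).trans_eq ?_
    rw [← Real.exp_nat_mul, hnorm, mul_comm K, mul_inv_cancel_left₀ hn', div_inv_eq_mul]
    ring
  have := hdiff.add (tendsto_const_nhds.congr' (hEpow.mono fun n hn => hn.symm))
  simpa using this

end TrotterProduct

section TransferMatrix

/-- The entries of an ordered product of matrices as a sum over paths. -/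
theorem List.prod_reverse_ofFn_apply {ι R : Type*} [Fintype ι] [DecidableEq ι] [CommSemiring R]
    (n : ℕ) (N : Fin (n + 1) → Matrix ι ι R) (a b : ι) :
    (List.ofFn N).reverse.prod b a =
      ∑ c : Fin n → ι, ∏ j, N j (Fin.snoc (α := fun _ => ι) c b j)
        (Fin.cons (α := fun _ => ι) a c j) := by
  induction n generalizing a with
  | zero => simp [Fin.snoc]
  | succ n ih =>
    rw [List.ofFn_succ, List.reverse_cons, List.prod_append, List.prod_singleton,
      Matrix.mul_apply, ← (Fin.consEquiv fun _ => ι).sum_comp, Fintype.sum_prod_type]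
    refine Finset.sum_congr rfl fun d _ => ?_
    rw [ih, Finset.sum_mul]
    refine Finset.sum_congr rfl fun c _ => ?_
    rw [Fin.prod_univ_succ (n := n + 1), mul_comm]
    simp only [Fin.consEquiv, Equiv.coe_fn_mk, ← Fin.cons_snoc_eq_snoc_cons, Fin.cons_zero,
      Fin.cons_succ]

theorem List.trace_prod_reverse_ofFn {ι R : Type*} [Fintype ι] [DecidableEq ι] [CommSemiring R]
    (L : ℕ) [NeZero L] (N : Fin L → Matrix ι ι R) :
    ∑ a, (List.ofFn N).reverse.prod a a = ∑ c : Fin L → ι, ∏ j, N j (c (j + 1)) (c j) := by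
  obtain ⟨n, rfl⟩ := Nat.exists_eq_succ_of_ne_zero (NeZero.ne L)
  rw [← (Fin.consEquiv fun _ => ι).sum_comp, Fintype.sum_prod_type]
  refine Finset.sum_congr rfl fun a _ => ?_
  rw [List.prod_reverse_ofFn_apply]
  refine Finset.sum_congr rfl fun c _ => Finset.prod_congr rfl fun j _ => ?_
  refine congrArg₂ _ ?_ rfl
  induction j using Fin.lastCases with
  | last => simp [Fin.consEquiv]
  | cast j => simp [Fin.consEquiv, Fin.coeSucc_eq_succ]

/-- The matrix on the auxiliary space obtained by fixing the states of a site. -/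
noncomputable def auxBlock (η lam : ℂ) (x y : Fin 2) : Matrix (Fin 2) (Fin 2) ℂ :=
  Matrix.of fun a b => Rmat η lam (a, x) (b, y)

theorem prod_map_Raux_apply (L : ℕ) (η lam : ℂ) (l : List (Fin L)) (hl : l.Nodup)
    (a b : Fin 2) (v w : Chain L) :
    (l.map (Raux L η lam)).prod (a, v) (b, w) =
      (l.map fun j => auxBlock η lam (v j) (w j)).prod a b *
        if ∀ k, k ∉ l → v k = w k then 1 else 0 := by
  induction l generalizing a v with
  | nil =>
    simp [Matrix.one_apply, ← funext_iff, ← ite_and, and_comm]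
  | cons i l ih =>
    obtain ⟨hi, hl⟩ := List.nodup_cons.1 hl
    simp only [List.map_cons, List.prod_cons, Matrix.mul_apply, Fintype.sum_prod_type,
      Finset.sum_mul]
    refine Finset.sum_congr rfl fun d _ => ?_
    rw [Finset.sum_eq_single (Function.update v i (w i))]
    · have hmap : (l.map fun j => auxBlock η lam (Function.update v i (w i) j) (w j)) =
          l.map fun j => auxBlock η lam (v j) (w j) := by
        refine List.map_congr_left fun j hj => ?_
        rw [Function.update_of_ne (ne_of_mem_of_not_mem hj hi)]
      have hiff : (∀ k, k ∉ l → Function.update v i (w i) k = w k) ↔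
          ∀ k, k ∉ i :: l → v k = w k := by
        refine forall_congr' fun k => ?_
        by_cases hk : k = i
        · simp [hk]
        · simp [hk]
      have hR : ∀ k, k ≠ i → v k = Function.update v i (w i) k := fun k hk => by simp [hk]
      rw [ih hl, hmap]
      simp only [hiff, Raux, Matrix.of_apply, if_pos hR, auxBlock, Function.update_self]
      ring
    · intro u _ hu
      rw [ih hl, Raux, Matrix.of_apply]
      by_cases h : (∀ k, k ≠ i → v k = u k) ∧ ∀ k, k ∉ l → u k = w k
      · refine absurd (funext fun k => ?_) hu
        by_cases hk : k = i
        · subst hk; simpa using h.2 k hi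
        · simpa [hk] using (h.1 k hk).symm
      · rw [not_and_or] at h
        rcases h with h | h <;> simp only [if_neg h, mul_zero, zero_mul]
    · simp

/-- The entries of the transfer matrix as a sum over closed auxiliary paths. -/
theorem transfer_apply (L : ℕ) [NeZero L] (η lam : ℂ) (v w : Chain L) :
    transfer L η lam v w = ∑ c : Chain L, ∏ j, Rmat η lam (c (j + 1), v j) (c j, w j) := by
  have h := List.trace_prod_reverse_ofFn L fun j => auxBlock η lam (v j) (w j)
  simp only [auxBlock, Matrix.of_apply] at h
  rw [← h]
  simp only [transfer, Matrix.of_apply, monodromy]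
  refine Finset.sum_congr rfl fun a _ => ?_
  rw [List.ofFn_eq_map, ← List.map_reverse, prod_map_Raux_apply _ _ _ _
    (List.nodup_reverse.2 (List.nodup_finRange L)), if_pos (by simp), mul_one,
    List.ofFn_eq_map, ← List.map_reverse]
  rfl

theorem Rmat_zero {η : ℂ} (hη : Complex.sinh η ≠ 0) (p q : Fin 2 × Fin 2) :
    Rmat η 0 p q = if p.1 = q.2 ∧ p.2 = q.1 then 1 else 0 := by
  obtain ⟨a, b⟩ := p
  obtain ⟨c, d⟩ := q
  fin_cases a <;> fin_cases b <;> fin_cases c <;> fin_cases d <;> simp [Rmat, hη]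

/-- The derivative of the R-matrix at `0`. -/
noncomputable def RmatDeriv (η : ℂ) : Matrix (Fin 2 × Fin 2) (Fin 2 × Fin 2) ℂ :=
  Matrix.of fun p q =>
    if p = q then (if p.1 = p.2 then 0 else (Complex.sinh η)⁻¹)
    else if p.1 = q.2 ∧ p.2 = q.1 ∧ p.1 ≠ p.2 then -Complex.cosh η / Complex.sinh η
    else 0

theorem hasDerivAt_Rmat {η : ℂ} (hη : Complex.sinh η ≠ 0) (p q : Fin 2 × Fin 2) :
    HasDerivAt (fun lam => Rmat η lam p q) (RmatDeriv η p q) 0 := by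
  have hden : HasDerivAt (fun lam => Complex.sinh (lam + η)) (Complex.cosh η) 0 := by
    simpa using ((hasDerivAt_id (0 : ℂ)).add_const η).csinh
  have hden0 : Complex.sinh (0 + η) ≠ 0 := by simpa using hη
  simp only [Rmat, RmatDeriv, Matrix.of_apply]
  split_ifs
  · exact hasDerivAt_const _ _
  · convert! (Complex.hasDerivAt_sinh 0).div hden hden0 using 1
    simp only [Complex.sinh_zero, Complex.cosh_zero, zero_add]
    field_simp
    ring
  · convert! (hasDerivAt_const (0 : ℂ) (Complex.sinh η)).div hden hden0 using 1
    simp only [zero_add]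
    field_simp
    ring
  · exact hasDerivAt_const _ _

variable {L : ℕ} [NeZero L]

theorem transfer_zero_apply {η : ℂ} (hη : Complex.sinh η ≠ 0) (v w : Chain L) :
    transfer L η 0 v w = if v = fun j => w (j - 1) then 1 else 0 := by
  rw [transfer_apply, Finset.sum_eq_single v]
  · simp only [Rmat_zero hη, Finset.prod_ite_zero, and_true, Finset.prod_const_one]
    refine if_congr ⟨fun h => funext fun j => ?_, fun h j _ => ?_⟩ rfl rfl
    · simpa using h (j - 1) (Finset.mem_univ _)
    · rw [h]; simp
  · intro c _ hc
    obtain ⟨j, hj⟩ := Function.ne_iff.1 hc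
    exact Finset.prod_eq_zero (Finset.mem_univ j) (by simp [Rmat_zero hη, hj.symm])
  · simp

theorem transfer_zero_transpose_mul_apply {η : ℂ} (hη : Complex.sinh η ≠ 0)
    (X : Matrix (Chain L) (Chain L) ℂ) (u w : Chain L) :
    ((transfer L η 0)ᵀ * X) u w = X (fun j => u (j - 1)) w := by
  simp [Matrix.mul_apply, transfer_zero_apply hη]

theorem transfer_zero_transpose_mul_self {η : ℂ} (hη : Complex.sinh η ≠ 0) :
    (transfer L η 0)ᵀ * transfer L η 0 = 1 := by
  ext u w
  rw [transfer_zero_transpose_mul_apply hη, transfer_zero_apply hη, Matrix.one_apply]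
  refine if_congr ⟨fun h => funext fun j => ?_, fun h => by rw [h]⟩ rfl rfl
  simpa using congrFun h (j + 1)

theorem transfer_zero_inv {η : ℂ} (hη : Complex.sinh η ≠ 0) :
    (transfer L η 0)⁻¹ = (transfer L η 0)ᵀ :=
  Matrix.inv_eq_left_inv (transfer_zero_transpose_mul_self hη)

theorem transfer_zero_inv_mul_apply {η : ℂ} (hη : Complex.sinh η ≠ 0)
    (X : Matrix (Chain L) (Chain L) ℂ) (u w : Chain L) :
    ((transfer L η 0)⁻¹ * X) u w = X (fun j => u (j - 1)) w := by
  rw [transfer_zero_inv hη, transfer_zero_transpose_mul_apply hη]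

/-- The two-site operator with entries `h`, acting on the sites `j` and `j + 1`. -/
noncomputable def bondOp (h : Matrix (Fin 2 × Fin 2) (Fin 2 × Fin 2) ℂ) (j : Fin L) :
    Matrix (Chain L) (Chain L) ℂ :=
  Matrix.of fun v w => h (v j, v (j + 1)) (w j, w (j + 1)) *
    if ∀ k, k ≠ j → k ≠ j + 1 → v k = w k then 1 else 0

theorem Fin.add_one_ne_self_of_two_le (hL : 2 ≤ L) (j : Fin L) : j + 1 ≠ j := by
  obtain ⟨n, rfl⟩ := Nat.exists_eq_add_of_le' hL
  simp

theorem siteOp_mul_siteOp (hL : 2 ≤ L) (m m' : Matrix (Fin 2) (Fin 2) ℂ) (j : Fin L) :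
    siteOp L m j * siteOp L m' (j + 1) =
      bondOp (Matrix.of fun p q => m p.1 q.1 * m' p.2 q.2) j := by
  have hj := Fin.add_one_ne_self_of_two_le hL j
  ext v w
  rw [Matrix.mul_apply, Finset.sum_eq_single (Function.update v j (w j))]
  · have h₁ : ∀ k, k ≠ j → v k = Function.update v j (w j) k := fun k hk => by simp [hk]
    have h₂ : (∀ k, k ≠ j + 1 → Function.update v j (w j) k = w k) ↔
        ∀ k, k ≠ j → k ≠ j + 1 → v k = w k := by
      refine forall_congr' fun k => ?_
      by_cases hk : k = j <;> simp [hk]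
    simp only [siteOp, bondOp, Matrix.of_apply, if_pos h₁, h₂, Function.update_self,
      Function.update_of_ne hj]
    ring
  · intro u _ hu
    simp only [siteOp, Matrix.of_apply]
    by_cases h : (∀ k, k ≠ j → v k = u k) ∧ ∀ k, k ≠ j + 1 → u k = w k
    · refine absurd (funext fun k => ?_) hu
      by_cases hk : k = j
      · subst hk; simpa using h.2 k hj.symm
      · simpa [hk] using (h.1 k hk).symm
    · rw [not_and_or] at h
      rcases h with h | h <;> simp only [if_neg h, mul_zero, zero_mul]
  · simp

theorem bondOp_one (j : Fin L) : bondOp 1 j = (1 : Matrix (Chain L) (Chain L) ℂ) := by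
  ext v w
  simp only [bondOp, Matrix.of_apply, Matrix.one_apply, ← ite_and, mul_ite, mul_one, mul_zero,
    Prod.mk.injEq]
  refine if_congr ⟨fun h => funext fun k => ?_, by rintro rfl; simp⟩ rfl rfl
  by_cases hk : k = j
  · rw [hk, h.2.1]
  by_cases hk' : k = j + 1
  · rw [hk', h.2.2]
  · exact h.1 k hk hk'

/-- The Hamiltonian density is the derivative of `P R(λ)` at `0`, up to a factor. -/
theorem xxz_density {η : ℂ} (hη : Complex.sinh η ≠ 0) (hL : 2 ≤ L) (j : Fin L) :
    siteOp L (pauli 0) j * siteOp L (pauli 0) (j + 1) +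
      siteOp L (pauli 1) j * siteOp L (pauli 1) (j + 1) +
      Complex.cosh η • (siteOp L (pauli 2) j * siteOp L (pauli 2) (j + 1) - 1) =
    (2 * Complex.sinh η) •
      bondOp (Matrix.of fun p q => RmatDeriv η p.swap q) j := by
  rw [← bondOp_one j]
  simp only [siteOp_mul_siteOp hL]
  ext v w
  simp only [bondOp, Matrix.of_apply, Matrix.add_apply, Matrix.sub_apply, Matrix.smul_apply,
    smul_eq_mul, ← add_mul, ← sub_mul, ← mul_assoc]
  congr 1
  generalize v j = a, v (j + 1) = b, w j = c, w (j + 1) = d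
  fin_cases a <;> fin_cases b <;> fin_cases c <;> fin_cases d <;>
    simp [pauli, RmatDeriv, hη] <;> field_simp <;> norm_num

theorem hasDerivAt_transfer {η : ℂ} (hη : Complex.sinh η ≠ 0) (v w : Chain L) :
    HasDerivAt (fun lam => transfer L η lam v w)
      (∑ k, ∑ c : Chain L, (∏ j ∈ Finset.univ.erase k,
        Rmat η 0 (c (j + 1), v j) (c j, w j)) * RmatDeriv η (c (k + 1), v k) (c k, w k)) 0 := by
  simp only [transfer_apply]
  rw [Finset.sum_comm]
  refine HasDerivAt.fun_sum fun c _ => ?_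
  simpa only [smul_eq_mul] using HasDerivAt.fun_finsetProd fun j _ =>
    hasDerivAt_Rmat hη (c (j + 1), v j) (c j, w j)

theorem sum_prod_erase_Rmat_zero {η : ℂ} (hη : Complex.sinh η ≠ 0) (hL : 2 ≤ L)
    (k : Fin L) (u w : Chain L) :
    (∑ c : Chain L, (∏ j ∈ Finset.univ.erase (k + 1),
        Rmat η 0 (c (j + 1), u (j - 1)) (c j, w j)) *
        RmatDeriv η (c (k + 1 + 1), u (k + 1 - 1)) (c (k + 1), w (k + 1))) =
      bondOp (Matrix.of fun p q => RmatDeriv η p.swap q) k u w := by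
  have hne := Fin.add_one_ne_self_of_two_le hL
  rw [Finset.sum_eq_single (Function.update (fun j => u (j - 1)) (k + 1) (w k))]
  · simp only [Rmat_zero hη, Finset.prod_ite_zero, Finset.prod_const_one, bondOp,
      Matrix.of_apply, Function.update_self, Function.update_of_ne (hne (k + 1)),
      add_sub_cancel_right, Prod.swap_prod_mk]
    rw [mul_comm]
    congr 1
    refine if_congr ⟨fun h j hj hj' => ?_, fun h j hj => ?_⟩ rfl rfl
    · have := (h j (by simp [hj'])).1
      rwa [Function.update_of_ne (by simpa using hj), add_sub_cancel_right] at this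
    · have hj' : j ≠ k + 1 := by simpa using hj
      refine ⟨?_, by simp [hj']⟩
      by_cases hjk : j = k
      · simp [hjk]
      · rw [Function.update_of_ne (by simpa using hjk)]
        simpa using h j hjk hj'
  · intro c _ hc
    obtain ⟨j, hj⟩ := Function.ne_iff.1 hc
    refine mul_eq_zero_of_left ?_ _
    by_cases hjk : j = k + 1
    · subst hjk
      refine Finset.prod_eq_zero (i := k) (by simp [(hne k).symm]) ?_
      rw [Function.update_self] at hj
      simp [Rmat_zero hη, hj]
    · refine Finset.prod_eq_zero (i := j) (by simp [hjk]) ?_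
      rw [Function.update_of_ne hjk] at hj
      simp [Rmat_zero hη, hj.symm]
  · simp

theorem hasDerivAt_transfer_zero_inv_mul_apply {η : ℂ} (hη : Complex.sinh η ≠ 0) (hL : 2 ≤ L)
    {J : ℝ} (hJ : J ≠ 0) (u w : Chain L) :
    HasDerivAt (fun lam => ((transfer L η 0)⁻¹ * transfer L η lam) u w)
      (((2 * (J : ℂ) * Complex.sinh η)⁻¹ • XXZham L J (Complex.cosh η)) u w) 0 := by
  have hJ' : (J : ℂ) ≠ 0 := by exact_mod_cast hJ
  simp only [transfer_zero_inv_mul_apply hη]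
  convert! hasDerivAt_transfer hη (fun j => u (j - 1)) w using 1
  rw [← Equiv.sum_comp (Equiv.addRight (1 : Fin L))]
  simp only [Equiv.coe_addRight, sum_prod_erase_Rmat_zero hη hL]
  simp only [XXZham, xxz_density hη hL, ← Finset.smul_sum, smul_smul]
  rw [show (2 * (J : ℂ) * Complex.sinh η)⁻¹ * (J * (2 * Complex.sinh η)) = 1 by field_simp,
    one_smul, Matrix.sum_apply]

end TransferMatrix

theorem mexp_eq_exp {ι : Type*} [Fintype ι] [DecidableEq ι] (A : Matrix ι ι ℂ) :
    mexp A = NormedSpace.exp A := by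
  rw [NormedSpace.exp_eq_tsum ℂ]
  rfl

theorem Matrix.tendsto_pow_inv_natCast_mexp {ι : Type*} [Fintype ι] [DecidableEq ι] [Nonempty ι]
    {G : ℂ → Matrix ι ι ℂ} {X : Matrix ι ι ℂ}
    (hG : ∀ i j, HasDerivAt (fun t => G t i j) (X i j) 0) (h0 : G 0 = 1) :
    Filter.Tendsto (fun n : ℕ => G ((n : ℂ)⁻¹) ^ n) Filter.atTop (nhds (mexp X)) := by
  let _ : NormedRing (Matrix ι ι ℂ) := Matrix.linftyOpNormedRing
  let _ : NormedAlgebra ℂ (Matrix ι ι ℂ) := Matrix.linftyOpNormedAlgebra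
  have : NormOneClass (Matrix ι ι ℂ) := Matrix.linfty_opNormOneClass
  have : CompleteSpace (Matrix ι ι ℂ) := FiniteDimensional.complete ℂ _
  have hG' : HasDerivAt G X 0 := hasDerivAt_pi.2 fun i => hasDerivAt_pi.2 fun j => hG i j
  rw [mexp_eq_exp]
  exact hG'.tendsto_pow_inv_natCast_exp h0

theorem HasDerivAt.comp_const_mul_zero {f : ℂ → ℂ} {f' : ℂ} (hf : HasDerivAt f f' 0) (c : ℂ) :
    HasDerivAt (fun t => f (c * t)) (c * f') 0 := by
  rw [← mul_zero c] at hf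
  simpa [Function.comp_def, mul_comm] using
    hf.comp (0 : ℂ) ((hasDerivAt_id (0 : ℂ)).const_mul c)

/-- The Trotter-type limit `lim_{M→∞} [T(0)⁻¹ T(β/(2M))]^M = exp(β H₀/(4 J sinh η))`
in the space of linear operators on `(ℂ²)^{⊗L}` (with `Δ = cosh η`). -/
theorem trotter_limit (L : ℕ) [NeZero L] (hL : 2 ≤ L) (J : ℝ) (hJ : J ≠ 0)
    (η : ℂ) (hη : Complex.sinh η ≠ 0) (β : ℂ) :
    Filter.Tendsto
      (fun M : ℕ => ((transfer L η 0)⁻¹ * transfer L η (β / (2 * (M : ℂ)))) ^ M)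
      Filter.atTop
      (nhds (mexp ((β / (4 * (J : ℂ) * Complex.sinh η)) • XXZham L J (Complex.cosh η)))) := by
  have hJ' : (J : ℂ) ≠ 0 := by exact_mod_cast hJ
  have hcoef : β / (4 * (J : ℂ) * Complex.sinh η) =
      β / 2 * (2 * (J : ℂ) * Complex.sinh η)⁻¹ := by
    field_simp
    norm_num
  rw [hcoef, mul_smul]
  have hG : ∀ u w, HasDerivAt
      (fun t => ((transfer L η 0)⁻¹ * transfer L η (β / 2 * t)) u w)
      (((β / 2) • (2 * (J : ℂ) * Complex.sinh η)⁻¹ • XXZham L J (Complex.cosh η)) u w) 0 :=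
    fun u w =>
      (hasDerivAt_transfer_zero_inv_mul_apply hη hL hJ u w).comp_const_mul_zero (β / 2)
  have h0 : (transfer L η 0)⁻¹ * transfer L η (β / 2 * 0) = 1 := by
    rw [mul_zero, transfer_zero_inv hη, transfer_zero_transpose_mul_self hη]
  refine (Matrix.tendsto_pow_inv_natCast_mexp hG h0).congr fun M => ?_
  rw [← div_eq_mul_inv, div_div]
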